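/- Let X be a reflexive Banach space and Y an arbitrary Banach space over K (ℝ or ℂ), and suppose the space K(X,Y) of compact operators is an M-ideal in L(X,Y). Let T ∈ L(X,Y) satisfy: (i) ‖T‖ = 1 and dist(T, K(X,Y)) < 1; (ii) M_T ∩ Ext(B_X) is a finite set; (iii) for each x ∈ M_T ∩ Ext(B_X), the span of J(Tx) is finite-dimensional. Then for any linear subspace W of L(X,Y), T ⊥_B W if and only if there exist a natural number n ≥ 1, vectors x_1,…,x_n ∈ M_T ∩ Ext(B_X), functionals y_i* ∈ Ext(J(T x_i)) for 1 ≤ i ≤ n, and scalars λ_1,…,λ_n > 0 with ∑_{i=1}^n λ_i = 1, such that ∑_{i=1}^n λ_i y_i*(A x_i) = 0 for every A ∈ W. -/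

import Mathlib

/-- `x` is an extreme point (with respect to real convex combinations) of the set `s`
in a vector space over `𝕜 = ℝ` or `ℂ`. -/
def RealExtremePoint (𝕜 : Type*) {E : Type*} [RCLike 𝕜] [AddCommGroup E] [Module 𝕜 E]
    (s : Set E) (x : E) : Prop :=
  x ∈ s ∧ ∀ y ∈ s, ∀ z ∈ s, ∀ t : ℝ, 0 < t → t < 1 →
    x = ((t : 𝕜)) • y + (((1 - t : ℝ) : 𝕜)) • z → y = x ∧ z = x

section

open Set

theorem isCompact_convexHull_union {E : Type*} [AddCommGroup E] [Module ℝ E] [TopologicalSpace E]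
    [ContinuousAdd E] [ContinuousSMul ℝ E] {s t : Set E} (hs : IsCompact s) (ht : IsCompact t)
    (hsc : Convex ℝ s) (htc : Convex ℝ t) : IsCompact (convexHull ℝ (s ∪ t)) := by
  rcases s.eq_empty_or_nonempty with rfl | hs0
  · simpa [htc.convexHull_eq] using ht
  rcases t.eq_empty_or_nonempty with rfl | ht0
  · simpa [hsc.convexHull_eq] using hs
  have h : convexHull ℝ (s ∪ t) =
      (fun p : ℝ × E × E => (1 - p.1) • p.2.1 + p.1 • p.2.2) '' (Icc (0 : ℝ) 1 ×ˢ s ×ˢ t) := by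
    rw [hsc.convexHull_union htc hs0 ht0]
    ext z
    simp only [mem_convexJoin, segment_eq_image, mem_image, mem_prod, Prod.exists]
    constructor
    · rintro ⟨a, ha, b, hb, θ, hθ, rfl⟩
      exact ⟨θ, a, b, ⟨hθ, ha, hb⟩, rfl⟩
    · rintro ⟨θ, a, b, ⟨hθ, ha, hb⟩, rfl⟩
      exact ⟨a, ha, b, hb, θ, hθ, rfl⟩
  rw [h]
  exact (isCompact_Icc.prod (hs.prod ht)).image (by fun_prop)

theorem isCompact_convexHull_biUnion {E ι : Type*} [AddCommGroup E] [Module ℝ E]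
    [TopologicalSpace E] [ContinuousAdd E] [ContinuousSMul ℝ E] (I : Finset ι) {s : ι → Set E}
    (hs : ∀ i ∈ I, IsCompact (s i)) (hsc : ∀ i ∈ I, Convex ℝ (s i)) :
    IsCompact (convexHull ℝ (⋃ i ∈ I, s i)) := by
  classical
  induction I using Finset.induction_on with
  | empty => simp
  | insert a I _ ih =>
    have h : convexHull ℝ (⋃ i ∈ insert a I, s i) =
        convexHull ℝ (s a ∪ convexHull ℝ (⋃ i ∈ I, s i)) := by
      rw [Finset.set_biUnion_insert, convexHull_convexHull_union_right]
    rw [h]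
    exact isCompact_convexHull_union (hs a (by simp)) (ih (fun i hi => hs i (by simp [hi]))
      (fun i hi => hsc i (by simp [hi]))) (hsc a (by simp)) (convex_convexHull _ _)

/-- Milman's partial converse to the Krein-Milman theorem. -/
theorem extremePoints_subset_of_subset_closure_convexHull {E : Type*} [AddCommGroup E] [Module ℝ E]
    [TopologicalSpace E] [T2Space E] [IsTopologicalAddGroup E] [ContinuousSMul ℝ E]
    [LocallyConvexSpace ℝ E] {s D : Set E} (hs : IsCompact s) (hsc : Convex ℝ s)
    (hD : IsCompact D) (hDs : D ⊆ s) (hsD : s ⊆ closure (convexHull ℝ D)) :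
    s.extremePoints ℝ ⊆ D := by
  intro e he
  by_contra heD
  have hsep : ∀ d : E, ∃ U : Set E, (d ∈ D → U ∈ nhds d) ∧ IsClosed U ∧ Convex ℝ U ∧ e ∉ U := by
    intro d
    by_cases hd : d ∈ D
    · have hne : d ≠ e := fun h => heD (h ▸ hd)
      obtain ⟨f, hf⟩ := geometric_hahn_banach_point_point hne
      obtain ⟨c, hc1, hc2⟩ := exists_between hf
      refine ⟨{z | f z ≤ c}, fun _ => ?_, isClosed_le f.continuous continuous_const,
        convex_halfSpace_le f.isLinear c, by simpa using hc2⟩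
      exact Filter.mem_of_superset ((isOpen_lt f.continuous continuous_const).mem_nhds hc1)
        fun z (hz : f z < c) => hz.le
    · exact ⟨∅, fun h => absurd h hd, isClosed_empty, convex_empty, by simp⟩
  choose U hUn hUc hUconv heU using hsep
  obtain ⟨I, -, hI⟩ := hD.elim_nhds_subcover U hUn
  have hcomp : IsCompact (convexHull ℝ (⋃ d ∈ I, s ∩ U d)) :=
    isCompact_convexHull_biUnion I (fun d _ => hs.inter_right (hUc d))
      (fun d _ => hsc.inter (hUconv d))
  have hsub : convexHull ℝ (⋃ d ∈ I, s ∩ U d) ⊆ s :=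
    convexHull_min (iUnion₂_subset fun _ _ => inter_subset_left) hsc
  have hsub' : s ⊆ convexHull ℝ (⋃ d ∈ I, s ∩ U d) := by
    refine hsD.trans (closure_minimal (convexHull_mono fun d hd => ?_) hcomp.isClosed)
    obtain ⟨i, hi, hdi⟩ := mem_iUnion₂.1 (hI hd)
    exact mem_iUnion₂.2 ⟨i, hi, hDs hd, hdi⟩
  rw [hsub'.antisymm hsub] at he
  obtain ⟨i, -, hi⟩ := mem_iUnion₂.1 (extremePoints_convexHull_subset he)
  exact heU i hi.2

theorem eq_and_eq_of_convex_comb_eq {α β p q m : ℝ} (hα : 0 < α) (hβ : 0 < β) (hαβ : α + β = 1)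
    (hp : p ≤ m) (hq : q ≤ m) (h : α * p + β * q = m) : p = m ∧ q = m := by
  have hsum : α * (m - p) + β * (m - q) = 0 := by linear_combination m * hαβ - h
  have h1 := mul_nonneg hα.le (sub_nonneg.2 hp)
  have h2 := mul_nonneg hβ.le (sub_nonneg.2 hq)
  have h3 : α * (m - p) = 0 := by linarith
  have h4 : β * (m - q) = 0 := by linarith
  constructor
  · linarith [(mul_eq_zero.1 h3).resolve_left hα.ne']
  · linarith [(mul_eq_zero.1 h4).resolve_left hβ.ne']

theorem exists_linearMap_forall_le_of_notMem_convexHull_extremePoints {V : Type*}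
    [NormedAddCommGroup V] [NormedSpace ℝ V] [FiniteDimensional ℝ V] {s : Set V}
    (hs : IsCompact s) (hsc : Convex ℝ s) {x : V} (hx : x ∈ s)
    (hxC : x ∉ convexHull ℝ (s.extremePoints ℝ)) :
    ∃ f : V →ₗ[ℝ] ℝ, f ≠ 0 ∧ ∀ y ∈ s, f y ≤ f x := by
  set C := convexHull ℝ (s.extremePoints ℝ) with hC
  have hCc : Convex ℝ C := convex_convexHull _ _
  have hcl : closure C = s := closure_convexHull_extremePoints hs hsc
  have hle : ∀ f : V →ₗ[ℝ] ℝ, (∀ y ∈ C, f y ≤ f x) → ∀ y ∈ s, f y ≤ f x := by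
    intro f hf y hy
    have hsub : closure C ⊆ {z | f z ≤ f x} :=
      closure_minimal hf (isClosed_le f.continuous_of_finiteDimensional continuous_const)
    exact hsub (hcl ▸ hy)
  by_cases hint : (interior C).Nonempty
  · obtain ⟨f, u, hf0, hfC, hfx⟩ := geometric_hahn_banach_of_nonempty_interior hCc
      (convex_singleton x) (disjoint_singleton_right.2 fun h => hxC (interior_subset h)) hint
      (singleton_nonempty x)
    refine ⟨f, fun h => hf0 (ContinuousLinearMap.coe_injective h), hle _ fun y hy => ?_⟩
    exact (hfC y hy).trans (hfx x rfl)
  · have hspan : affineSpan ℝ C ≠ ⊤ := fun h =>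
      hint (hCc.interior_nonempty_iff_affineSpan_eq_top.2 h)
    have hsub : s ⊆ affineSpan ℝ C := by
      rw [← hcl]
      exact closure_minimal (subset_affineSpan ℝ C) (affineSpan ℝ C).closed_of_finiteDimensional
    have hdir : (affineSpan ℝ C).direction ≠ ⊤ := fun h =>
      hspan ((AffineSubspace.direction_eq_top_iff_of_nonempty ⟨x, hsub hx⟩).1 h)
    obtain ⟨v, -, hv⟩ := SetLike.exists_of_lt hdir.lt_top
    obtain ⟨f, hfv, hf⟩ := Submodule.exists_dual_map_eq_bot_of_notMem hv inferInstance
    refine ⟨f, fun h => hfv (by simp [h]), fun y hy => ?_⟩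
    have hmem : y - x ∈ (affineSpan ℝ C).direction :=
      AffineSubspace.vsub_mem_direction (hsub hy) (hsub hx)
    have h0 : f (y - x) = 0 := by
      have := Submodule.mem_map_of_mem (f := f) hmem
      rwa [hf, Submodule.mem_bot] at this
    rw [map_sub, sub_eq_zero] at h0
    exact h0.le

/-- Minkowski's theorem: in finite dimension, a compact convex set is the convex hull of its
extreme points, without taking the closure. -/
theorem subset_convexHull_extremePoints {V : Type*} [NormedAddCommGroup V] [NormedSpace ℝ V]
    [FiniteDimensional ℝ V] {s : Set V} (hs : IsCompact s) (hsc : Convex ℝ s) :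
    s ⊆ convexHull ℝ (s.extremePoints ℝ) := by
  induction hn : Module.finrank ℝ V using Nat.strong_induction_on generalizing V with
  | _ n ih =>
  intro x hx
  by_contra hxC
  obtain ⟨f, hf0, hfx⟩ :=
    exists_linearMap_forall_le_of_notMem_convexHull_extremePoints hs hsc hx hxC
  have hlt : Module.finrank ℝ (LinearMap.ker f) < n := by
    have := Module.Dual.finrank_ker_add_one_of_ne_zero hf0
    omega
  let g : LinearMap.ker f →ᵃ[ℝ] V :=
    (AffineEquiv.constVAdd ℝ V x).toAffineMap.comp (LinearMap.ker f).subtype.toAffineMap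
  have hg : ∀ v, g v = x + v := fun v => rfl
  have hcomp : IsCompact (g ⁻¹' s) :=
    (((Homeomorph.addLeft x).isClosedEmbedding).comp
      (LinearMap.ker f).closed_of_finiteDimensional.isClosedEmbedding_subtypeVal).isCompact_preimage
      hs
  have h0 := ih _ hlt hcomp (hsc.affine_preimage g) rfl (show (0 : LinearMap.ker f) ∈ g ⁻¹' s by
    simpa [hg] using hx)
  have hxg : x ∈ convexHull ℝ (g '' (g ⁻¹' s).extremePoints ℝ) := by
    rw [← AffineMap.image_convexHull]
    exact ⟨0, h0, by simp [hg]⟩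
  refine hxC (convexHull_mono ?_ hxg)
  rintro _ ⟨v, hv, rfl⟩
  rw [mem_extremePoints_iff_left] at hv ⊢
  refine ⟨hv.1, fun a ha b hb hab => ?_⟩
  have hseg := hab
  obtain ⟨α, β, hα, hβ, hαβ, hsum⟩ := hab
  have hfv : α * f a + β * f b = f x := by
    have := congrArg f hsum
    simpa [hg, LinearMap.mem_ker.1 v.2] using this
  obtain ⟨hfa, hfb⟩ := eq_and_eq_of_convex_comb_eq hα hβ hαβ (hfx a ha) (hfx b hb) hfv
  have key : ∀ c, f c = f x → ∃ w : LinearMap.ker f, g w = c := fun c hc =>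
    ⟨⟨c - x, by simp [hc]⟩, by simp [hg]⟩
  obtain ⟨a', rfl⟩ := key a hfa
  obtain ⟨b', rfl⟩ := key b hfb
  refine congrArg g (hv.2 a' ha b' hb ⟨α, β, hα, hβ, hαβ, ?_⟩)
  apply Subtype.ext
  have h1 : α • (x + (a' : V)) + β • (x + (b' : V)) = x + v := hsum
  have h2 : α • x + β • x = x := by rw [← add_smul, hαβ, one_smul]
  have h3 : x + (α • (a' : V) + β • (b' : V)) = x + v := by
    rw [← h1]; nth_rewrite 1 [← h2]; simp only [smul_add]; abel
  simpa using add_left_cancel h3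

theorem WeakDual.locallyConvexSpace_real (𝕜 E : Type*) [RCLike 𝕜] [NormedAddCommGroup E]
    [NormedSpace 𝕜 E] : LocallyConvexSpace ℝ (WeakDual 𝕜 E) :=
  WeakBilin.locallyConvexSpace (B := topDualPairing 𝕜 E)

theorem WeakDual.isScalarTower_real (𝕜 E : Type*) [RCLike 𝕜] [NormedAddCommGroup E]
    [NormedSpace 𝕜 E] : IsScalarTower ℝ 𝕜 (WeakDual 𝕜 E) :=
  inferInstanceAs (IsScalarTower ℝ 𝕜 (StrongDual 𝕜 E))

theorem WeakDual.exists_apply_eq {𝕜 E : Type*} [RCLike 𝕜] [NormedAddCommGroup E]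
    [NormedSpace 𝕜 E] (f : StrongDual 𝕜 (WeakDual 𝕜 E)) : ∃ x : E, ∀ φ, f φ = φ x := by
  obtain ⟨x, hx⟩ := LinearMap.dualEmbedding_surjective (topDualPairing 𝕜 E) f
  exact ⟨x, fun φ => (DFunLike.congr_fun hx φ).symm⟩

/-- The dual unit ball, as a set in the weak* topology. -/
def WeakDual.unitBall (𝕜 E : Type*) [RCLike 𝕜] [NormedAddCommGroup E] [NormedSpace 𝕜 E] :
    Set (WeakDual 𝕜 E) :=
  {φ | ‖WeakDual.toStrongDual φ‖ ≤ 1}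

theorem WeakDual.unitBall_eq (𝕜 E : Type*) [RCLike 𝕜] [NormedAddCommGroup E] [NormedSpace 𝕜 E] :
    WeakDual.unitBall 𝕜 E = WeakDual.toStrongDual ⁻¹' Metric.closedBall 0 1 :=
  Set.ext fun _ => mem_closedBall_zero_iff.symm

theorem WeakDual.isCompact_unitBall (𝕜 E : Type*) [RCLike 𝕜] [NormedAddCommGroup E]
    [NormedSpace 𝕜 E] : IsCompact (WeakDual.unitBall 𝕜 E) :=
  WeakDual.unitBall_eq 𝕜 E ▸ WeakDual.isCompact_closedBall 0 1

theorem WeakDual.convex_unitBall (𝕜 E : Type*) [RCLike 𝕜] [NormedAddCommGroup E]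
    [NormedSpace 𝕜 E] : Convex ℝ (WeakDual.unitBall 𝕜 E) := by
  have := WeakDual.isScalarTower_real 𝕜 E
  rw [WeakDual.unitBall_eq]
  exact (convex_closedBall (0 : StrongDual 𝕜 E) 1).linear_preimage
    ((WeakDual.toStrongDual : WeakDual 𝕜 E ≃ₗ[𝕜] StrongDual 𝕜 E).toLinearMap.restrictScalars ℝ)

section CompactEval

variable {𝕜 X Y Z : Type*} [RCLike 𝕜] [NormedAddCommGroup X] [NormedSpace 𝕜 X]
  [NormedAddCommGroup Y] [NormedSpace 𝕜 Y] [NormedAddCommGroup Z] [NormedSpace 𝕜 Z]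

/-- Precomposition with a compact operator is weak*-to-norm continuous on the dual unit ball. -/
theorem IsCompactOperator.continuousOn_comp {S : X →L[𝕜] Y} (hS : IsCompactOperator S) :
    ContinuousOn (fun y : WeakDual 𝕜 Y => (WeakDual.toStrongDual y).comp S)
      (WeakDual.unitBall 𝕜 _) := by
  intro y₀ hy₀
  rw [ContinuousWithinAt, Metric.tendsto_nhds]
  intro ε hε
  have hcpt : IsCompact (closure (S '' Metric.closedBall 0 1)) :=
    IsCompactOperator.isCompact_closure_image_closedBall (f := (S : X →ₗ[𝕜] Y)) hS 1
  obtain ⟨t, -, htf, ht⟩ := exists_finite_cover_balls_of_isCompact_closure hcpt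
    (show (0 : ℝ) < ε / 6 by positivity)
  have hev : ∀ᶠ y : WeakDual 𝕜 Y in nhds y₀, ∀ z ∈ t, dist (y z) (y₀ z) < ε / 6 :=
    (Filter.eventually_all_finite htf).2 fun z _ =>
      Metric.tendsto_nhds.1 (WeakDual.eval_continuous z).continuousAt _ (by positivity)
  filter_upwards [mem_nhdsWithin_of_mem_nhds hev, self_mem_nhdsWithin] with y hy hyb
  rw [dist_eq_norm]
  have hn : ∀ w : WeakDual 𝕜 Y, w ∈ WeakDual.unitBall 𝕜 Y →
      ∀ v, ‖w v‖ ≤ ‖v‖ := fun w hw v => by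
    have := (WeakDual.toStrongDual w).le_of_opNorm_le hw v
    simpa using! this
  have hbd := ContinuousLinearMap.opNorm_bound_of_ball_bound one_pos (ε / 2)
    ((WeakDual.toStrongDual y).comp S - (WeakDual.toStrongDual y₀).comp S) fun x hx => by
      obtain ⟨z, hz, hzx⟩ := mem_iUnion₂.1 (ht (mem_image_of_mem S hx))
      have hSz : ‖S x - z‖ < ε / 6 := by rwa [← dist_eq_norm]
      have h1 := hn y hyb (S x - z)
      have h2 := hn y₀ hy₀ (S x - z)
      have h3 := hy z hz
      rw [dist_eq_norm] at h3
      have heq : ((WeakDual.toStrongDual y).comp S - (WeakDual.toStrongDual y₀).comp S) x =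
          y (S x - z) + (y z - y₀ z) - y₀ (S x - z) := by
        simp only [map_sub]
        change y (S x) - y₀ (S x) = _
        ring
      rw [heq]
      have h4 := norm_sub_le (y (S x - z) + (y z - y₀ z)) (y₀ (S x - z))
      have h5 := norm_add_le (y (S x - z)) (y z - y₀ z)
      linarith
  linarith

/-- The functional `S ↦ ξ (y ∘ S)` on compact operators, for `ξ` in the bidual of the domain and
`y` in the dual of the range. -/
noncomputable def compactEval (ι : Z →ₗᵢ[𝕜] (X →L[𝕜] Y))
    (p : WeakDual 𝕜 (StrongDual 𝕜 X) × WeakDual 𝕜 Y) :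
    WeakDual 𝕜 Z :=
  StrongDual.toWeakDual ((WeakDual.toStrongDual p.1).comp
    ((ContinuousLinearMap.compL 𝕜 X Y 𝕜 (WeakDual.toStrongDual p.2)).comp
      ι.toContinuousLinearMap))

theorem compactEval_apply (ι : Z →ₗᵢ[𝕜] (X →L[𝕜] Y))
    (p : WeakDual 𝕜 (StrongDual 𝕜 X) × WeakDual 𝕜 Y)
    (S : Z) :
    compactEval ι p S = p.1 ((WeakDual.toStrongDual p.2).comp (ι S)) := rfl

theorem isCompact_image_compactEval {ι : Z →ₗᵢ[𝕜] (X →L[𝕜] Y)}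
    (hι : ∀ S, IsCompactOperator (ι S)) :
    IsCompact (compactEval ι ''
      (WeakDual.unitBall 𝕜 _ ×ˢ
        WeakDual.unitBall 𝕜 _)) := by
  refine ((WeakDual.isCompact_unitBall _ _).prod
    (WeakDual.isCompact_unitBall _ _)).image_of_continuousOn ?_
  rw [continuousOn_iff_continuous_domRestrict]
  refine WeakDual.continuous_of_continuous_eval fun S => ?_
  refine (continuousOn_iff_continuous_domRestrict (f := fun p => compactEval ι p S)).1 ?_
  simp only [compactEval_apply]
  rintro ⟨ξ₀, y₀⟩ ⟨hξ₀, hy₀⟩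
  have hS := hι S
  rw [ContinuousWithinAt, tendsto_iff_norm_sub_tendsto_zero]
  have h1 : Filter.Tendsto (fun p : WeakDual 𝕜 (StrongDual 𝕜 X) × WeakDual 𝕜 Y =>
      (WeakDual.toStrongDual p.2).comp (ι S))
      (nhdsWithin (ξ₀, y₀) (WeakDual.unitBall 𝕜 _ ×ˢ
        WeakDual.unitBall 𝕜 _))
      (nhds ((WeakDual.toStrongDual y₀).comp (ι S))) := by
    rw [nhdsWithin_prod_eq]
    exact Filter.Tendsto.comp (hS.continuousOn_comp y₀ hy₀) Filter.tendsto_snd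
  have h2 : Filter.Tendsto (fun p : WeakDual 𝕜 (StrongDual 𝕜 X) × WeakDual 𝕜 Y =>
      p.1 ((WeakDual.toStrongDual y₀).comp (ι S)))
      (nhdsWithin (ξ₀, y₀) (WeakDual.unitBall 𝕜 _ ×ˢ
        WeakDual.unitBall 𝕜 _))
      (nhds (ξ₀ ((WeakDual.toStrongDual y₀).comp (ι S)))) :=
    (((WeakDual.eval_continuous _).comp continuous_fst).tendsto (ξ₀, y₀)).mono_left
      nhdsWithin_le_nhds
  rw [tendsto_iff_norm_sub_tendsto_zero] at h1 h2
  have h3 := h1.add h2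
  rw [add_zero] at h3
  refine squeeze_zero' (Filter.Eventually.of_forall fun _ => norm_nonneg _) ?_ h3
  filter_upwards [self_mem_nhdsWithin] with p hp
  have h4 := (WeakDual.toStrongDual p.1).le_of_opNorm_le hp.1
    ((WeakDual.toStrongDual p.2).comp (ι S) -
      (WeakDual.toStrongDual y₀).comp (ι S))
  rw [one_mul, map_sub] at h4
  exact (norm_sub_le_norm_sub_add_norm_sub _ _ _).trans (add_le_add_left h4 _)

theorem closedBall_subset_closure_convexHull_image_compactEval (ι : Z →ₗᵢ[𝕜] (X →L[𝕜] Y)) :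
    (WeakDual.unitBall 𝕜 Z) ⊆
    closure (convexHull ℝ (compactEval ι ''
      (WeakDual.unitBall 𝕜 _ ×ˢ
        WeakDual.unitBall 𝕜 _))) := by
  have := WeakDual.locallyConvexSpace_real 𝕜 Z
  have := WeakDual.isScalarTower_real 𝕜 Z
  intro φ hφ
  by_contra hcl
  obtain ⟨f, u, hfu, huφ⟩ := RCLike.geometric_hahn_banach_closed_point (𝕜 := 𝕜)
    (convex_convexHull ℝ _).closure isClosed_closure hcl
  obtain ⟨S, hS⟩ := WeakDual.exists_apply_eq f
  have hbound : ∀ x : X, ‖x‖ ≤ 1 → ‖(ι S) x‖ ≤ u := by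
    intro x hx
    obtain ⟨y, hy, hyS⟩ := exists_dual_vector'' 𝕜 ((ι S) x)
    have hmem : compactEval ι (StrongDual.toWeakDual (NormedSpace.inclusionInDoubleDual 𝕜 X x),
        StrongDual.toWeakDual y) ∈ compactEval ι ''
      (WeakDual.unitBall 𝕜 _ ×ˢ
        WeakDual.unitBall 𝕜 _) :=
      mem_image_of_mem _ ⟨(NormedSpace.double_dual_bound 𝕜 X x).trans hx, hy⟩
    have h := hfu _ (subset_closure (subset_convexHull ℝ _ hmem))
    rw [hS, compactEval_apply] at h
    have h' : RCLike.re (y ((ι S) x)) < u := h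
    rw [hyS, RCLike.ofReal_re] at h'
    exact h'.le
  have hu : 0 ≤ u := (norm_nonneg _).trans (hbound 0 (by simp))
  have hSu : ‖S‖ ≤ u := (ι.norm_map S).symm.trans_le <|
    ContinuousLinearMap.opNorm_le_of_unit_norm hu fun x hx => hbound x hx.le
  rw [hS] at huφ
  have h1 : ‖φ S‖ ≤ 1 * ‖S‖ :=
    (WeakDual.toStrongDual φ).le_of_opNorm_le hφ S
  linarith [RCLike.re_le_norm (φ S)]

theorem image_compactEval_subset (ι : Z →ₗᵢ[𝕜] (X →L[𝕜] Y)) :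
    compactEval ι '' (WeakDual.unitBall 𝕜 _ ×ˢ
        WeakDual.unitBall 𝕜 _) ⊆
      WeakDual.unitBall 𝕜 Z := by
  rintro _ ⟨⟨ξ, y⟩, ⟨hξ, hy⟩, rfl⟩
  refine ContinuousLinearMap.opNorm_le_bound _ zero_le_one fun S => ?_
  have h1 := (WeakDual.toStrongDual ξ).le_of_opNorm_le hξ ((WeakDual.toStrongDual y).comp (ι S))
  have h2 := (WeakDual.toStrongDual y).opNorm_comp_le (ι S)
  have h3 : ‖WeakDual.toStrongDual y‖ * ‖ι S‖ ≤ 1 * ‖S‖ :=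
    ι.norm_map S ▸ mul_le_mul_of_nonneg_right hy (norm_nonneg _)
  rw [one_mul] at h1
  exact h1.trans (h2.trans h3)

theorem exists_of_mem_extremePoints_dual {ι : Z →ₗᵢ[𝕜] (X →L[𝕜] Y)}
    (hι : ∀ S, IsCompactOperator (ι S))
    (hrefl : Function.Surjective (NormedSpace.inclusionInDoubleDual 𝕜 X))
    {e : WeakDual 𝕜 Z}
    (he : e ∈ (WeakDual.unitBall 𝕜 Z).extremePoints ℝ) :
    ∃ (x : X) (y : StrongDual 𝕜 Y), ‖x‖ ≤ 1 ∧ ‖y‖ ≤ 1 ∧ ∀ S : Z, e S = y ((ι S) x) := by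
  have := WeakDual.locallyConvexSpace_real 𝕜 Z
  have hext := extremePoints_subset_of_subset_closure_convexHull
    (D := compactEval ι '' (WeakDual.unitBall 𝕜 _ ×ˢ WeakDual.unitBall 𝕜 _))
    (WeakDual.isCompact_unitBall 𝕜 Z) (WeakDual.convex_unitBall 𝕜 Z)
    (isCompact_image_compactEval hι) (image_compactEval_subset ι)
    (closedBall_subset_closure_convexHull_image_compactEval ι)
  obtain ⟨⟨ξ, y⟩, ⟨hξ, hy⟩, hξy⟩ := hext he
  obtain ⟨x, hx⟩ := hrefl (WeakDual.toStrongDual ξ)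
  refine ⟨x, WeakDual.toStrongDual y, ?_, hy, fun S => ?_⟩
  · rw [← (NormedSpace.inclusionInDoubleDualLi 𝕜 (E := X)).norm_map x]
    exact (congrArg norm hx).le.trans hξ
  · rw [← hξy, compactEval_apply]
    exact (DFunLike.congr_fun hx _).symm

end CompactEval

/-- If the extreme points of a compact convex set lie in a finite-dimensional subspace, the set is
the convex hull of its extreme points. -/
theorem subset_convexHull_extremePoints_of_subset_submodule {F : Type*} [AddCommGroup F]
    [Module ℝ F] [TopologicalSpace F] [T2Space F] [IsTopologicalAddGroup F] [ContinuousSMul ℝ F]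
    [LocallyConvexSpace ℝ F] {s : Set F} (hs : IsCompact s) (hsc : Convex ℝ s)
    (V : Submodule ℝ F) [FiniteDimensional ℝ V] (hV : s.extremePoints ℝ ⊆ V) :
    s ⊆ convexHull ℝ (s.extremePoints ℝ) := by
  have hVcl : IsClosed (V : Set F) := V.closed_of_finiteDimensional
  have hsV : s ⊆ V := by
    rw [← closure_convexHull_extremePoints hs hsc]
    exact closure_minimal (convexHull_min hV V.convex) hVcl
  set g : EuclideanSpace ℝ (Fin (Module.finrank ℝ V)) →L[ℝ] F :=
    V.subtypeL.comp (toEuclidean (E := V)).symm.toContinuousLinearMap with hg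
  have hemb : Topology.IsClosedEmbedding g :=
    hVcl.isClosedEmbedding_subtypeVal.comp
      (toEuclidean (E := V)).symm.toHomeomorph.isClosedEmbedding
  have hsub : g '' (g ⁻¹' s).extremePoints ℝ ⊆ s.extremePoints ℝ := by
    rintro _ ⟨e, he, rfl⟩
    have hrange : ∀ a ∈ s, ∃ a', g a' = a := fun a ha =>
      ⟨toEuclidean (⟨a, hsV ha⟩ : V), by simp [hg]⟩
    refine ⟨he.1, fun a ha b hb hab => ?_⟩
    obtain ⟨a', rfl⟩ := hrange a ha
    obtain ⟨b', rfl⟩ := hrange b hb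
    obtain ⟨α, β, hα, hβ, hαβ, h⟩ := hab
    rw [← map_smul, ← map_smul, ← map_add] at h
    exact congrArg g (he.2 ha hb ⟨α, β, hα, hβ, hαβ, hemb.injective h⟩)
  intro x hx
  have hx' : toEuclidean (⟨x, hsV hx⟩ : V) ∈ g ⁻¹' s := by simpa [hg] using hx
  have h := subset_convexHull_extremePoints (hemb.isCompact_preimage hs)
    (hsc.linear_preimage (g : EuclideanSpace ℝ (Fin (Module.finrank ℝ V)) →ₗ[ℝ] F)) hx'
  have h2 := mem_image_of_mem (g : EuclideanSpace ℝ (Fin (Module.finrank ℝ V)) →ₗ[ℝ] F) h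
  rw [LinearMap.image_convexHull] at h2
  have h3 : g (toEuclidean (⟨x, hsV hx⟩ : V)) = x := by simp [hg]
  exact convexHull_mono hsub (h3 ▸ h2)

theorem realExtremePoint_iff {𝕜 E : Type*} [RCLike 𝕜] [AddCommGroup E] [Module 𝕜 E] [Module ℝ E]
    [IsScalarTower ℝ 𝕜 E] {s : Set E} {x : E} :
    RealExtremePoint 𝕜 s x ↔ x ∈ s.extremePoints ℝ := by
  rw [RealExtremePoint, mem_extremePoints]
  have hsmul : ∀ (t : ℝ) (y : E), (t : 𝕜) • y = t • y := fun t y => by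
    rw [RCLike.real_smul_eq_coe_smul (K := 𝕜)]
  simp only [hsmul]
  refine and_congr_right fun _ => forall₄_congr fun a _ b _ => ⟨?_, ?_⟩
  · rintro h ⟨α, β, hα, hβ, hαβ, hx⟩
    obtain rfl : β = 1 - α := by linarith
    exact h α hα (by linarith) hx.symm
  · rintro h t ht0 ht1 hx
    exact h ⟨t, 1 - t, ht0, sub_pos.2 ht1, by ring, hx.symm⟩

theorem eq_one_and_eq_one_of_convex_comb {𝕜 : Type*} [RCLike 𝕜] {α β : ℝ} {z w : 𝕜} (hα : 0 < α)
    (hβ : 0 < β) (hαβ : α + β = 1) (hz : ‖z‖ ≤ 1) (hw : ‖w‖ ≤ 1)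
    (h : (α : 𝕜) * z + (β : 𝕜) * w = 1) : z = 1 ∧ w = 1 := by
  have hre := congrArg RCLike.re h
  rw [map_add, RCLike.re_ofReal_mul, RCLike.re_ofReal_mul, RCLike.one_re] at hre
  obtain ⟨h1, h2⟩ := eq_and_eq_of_convex_comb_eq hα hβ hαβ ((RCLike.re_le_norm z).trans hz)
    ((RCLike.re_le_norm w).trans hw) hre
  constructor
  · rw [← RCLike.re_eq_self_of_le (hz.trans h1.ge), h1, RCLike.ofReal_one]
  · rw [← RCLike.re_eq_self_of_le (hw.trans h2.ge), h2, RCLike.ofReal_one]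

section LProjection

variable {𝕜 E : Type*} [RCLike 𝕜] [NormedAddCommGroup E] [NormedSpace 𝕜 E]

/-- The functionals in the dual unit ball with value one at a given vector. -/
def stateSet (𝕜 : Type*) {E : Type*} [RCLike 𝕜] [NormedAddCommGroup E] [NormedSpace 𝕜 E] (T : E) :
    Set (StrongDual 𝕜 E) :=
  {φ | ‖φ‖ ≤ 1 ∧ φ T = 1}

theorem one_le_norm_of_mem_stateSet {T : E} (hT : ‖T‖ = 1) {φ : StrongDual 𝕜 E}
    (hφ : φ ∈ stateSet 𝕜 T) : 1 ≤ ‖φ‖ := by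
  have h := φ.le_opNorm T
  rwa [hφ.2, hT, norm_one, mul_one] at h

variable {K : Submodule 𝕜 E} {P : StrongDual 𝕜 E →ₗ[𝕜] StrongDual 𝕜 E}

theorem map_eq_zero_of_mem_stateSet (hPnorm : ∀ φ, ‖φ‖ = ‖P φ‖ + ‖φ - P φ‖)
    (hPK : ∀ φ, ∀ S ∈ K, P φ S = 0) {T : E} (hT : ‖T‖ = 1) {k : E} (hk : k ∈ K)
    (hTk : ‖T - k‖ < 1) {φ : StrongDual 𝕜 E} (hφ : φ ∈ stateSet 𝕜 T) : P φ = 0 := by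
  have h1 : P φ (T - k) + (φ - P φ) T = 1 := by
    rw [map_sub, hPK φ k hk, sub_apply, hφ.2]
    ring
  have h2 := norm_add_le (P φ (T - k)) ((φ - P φ) T)
  rw [h1, norm_one] at h2
  have h3 := (P φ).le_opNorm (T - k)
  have h4 := (φ - P φ).le_opNorm T
  rw [hT, mul_one] at h4
  have h5 := hPnorm φ
  have h6 := hφ.1
  have h7 : ‖P φ‖ * (1 - ‖T - k‖) ≤ 0 := by linarith
  have h8 := nonpos_of_mul_nonpos_left h7 (sub_pos.2 hTk)
  exact norm_le_zero_iff.1 h8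

theorem eq_of_eqOn_of_map_eq_zero (hPP : ∀ φ, P (P φ) = P φ)
    (hPnorm : ∀ φ, ‖φ‖ = ‖P φ‖ + ‖φ - P φ‖)
    (hPrange : ∀ φ : StrongDual 𝕜 E, (∀ S ∈ K, φ S = 0) → φ ∈ Set.range P)
    {φ ψ : StrongDual 𝕜 E} (hφ : 1 ≤ ‖φ‖) (hPφ : P φ = 0) (hψ : ‖ψ‖ ≤ 1)
    (h : ∀ S ∈ K, ψ S = φ S) : ψ = φ := by
  obtain ⟨η, hη⟩ := hPrange (ψ - φ) fun S hS => by
    rw [sub_apply, h S hS, sub_self]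
  have h1 : P ψ = ψ - φ := by
    have h2 := hPP η
    rwa [hη, map_sub, hPφ, sub_zero] at h2
  have h3 := hPnorm ψ
  rw [h1, sub_sub_cancel] at h3
  exact sub_eq_zero.1 (norm_le_zero_iff.1 (by linarith))

theorem comp_subtypeL_mem_extremePoints (hPP : ∀ φ, P (P φ) = P φ)
    (hPnorm : ∀ φ, ‖φ‖ = ‖P φ‖ + ‖φ - P φ‖) (hPK : ∀ φ, ∀ S ∈ K, P φ S = 0)
    (hPrange : ∀ φ : StrongDual 𝕜 E, (∀ S ∈ K, φ S = 0) → φ ∈ Set.range P)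
    {T : E} (hT : ‖T‖ = 1) {k : E} (hk : k ∈ K) (hTk : ‖T - k‖ < 1) {e : StrongDual 𝕜 E}
    (he : RealExtremePoint 𝕜 (stateSet 𝕜 T) e) :
    RealExtremePoint 𝕜 {φ : StrongDual 𝕜 K | ‖φ‖ ≤ 1} (e.comp K.subtypeL) := by
  refine ⟨?_, fun a ha b hb t ht0 ht1 hab => ?_⟩
  · refine ContinuousLinearMap.opNorm_le_bound _ zero_le_one fun S => ?_
    exact e.le_of_opNorm_le he.1.1 S
  · obtain ⟨a', haa', ha'⟩ := exists_extension_norm_eq K a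
    obtain ⟨b', hbb', hb'⟩ := exists_extension_norm_eq K b
    rw [mem_ofPred_eq] at ha hb
    rw [← ha'] at ha
    rw [← hb'] at hb
    have ht1' := sub_pos.2 ht1
    have hψ : (t : 𝕜) • a' + ((1 - t : ℝ) : 𝕜) • b' = e := by
      refine eq_of_eqOn_of_map_eq_zero (K := K) hPP hPnorm hPrange
        (one_le_norm_of_mem_stateSet hT he.1)
        (map_eq_zero_of_mem_stateSet hPnorm hPK hT hk hTk he.1) ?_ fun S hS => ?_
      · refine (norm_add_le _ _).trans ?_
        rw [norm_smul, norm_smul, RCLike.norm_of_nonneg ht0.le, RCLike.norm_of_nonneg ht1'.le]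
        nlinarith
      · have h := DFunLike.congr_fun hab ⟨S, hS⟩
        simp only [add_apply, smul_apply, ← haa',
          ← hbb'] at h
        exact h.symm
    have hT1 := DFunLike.congr_fun hψ T
    simp only [add_apply, smul_apply, smul_eq_mul,
      he.1.2] at hT1
    have hle : ∀ f : StrongDual 𝕜 E, ‖f‖ ≤ 1 → ‖f T‖ ≤ 1 := fun f hf => by
      simpa [hT] using f.le_of_opNorm_le hf T
    obtain ⟨h1, h2⟩ := eq_one_and_eq_one_of_convex_comb ht0 ht1' (add_sub_cancel _ _)
      (hle a' ha) (hle b' hb) hT1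
    obtain ⟨rfl, rfl⟩ := he.2 a' ⟨ha, h1⟩ b' ⟨hb, h2⟩ t ht0 ht1 hψ.symm
    exact ⟨ContinuousLinearMap.ext fun S => (haa' S).symm,
      ContinuousLinearMap.ext fun S => (hbb' S).symm⟩

end LProjection

section EvalFunctional

variable {𝕜 X Y : Type*} [RCLike 𝕜] [NormedAddCommGroup X] [NormedSpace 𝕜 X]
  [NormedAddCommGroup Y] [NormedSpace 𝕜 Y]

/-- The functional `S ↦ y (S x)` on bounded operators. -/
noncomputable def evalFunctional (y : StrongDual 𝕜 Y) (x : X) : StrongDual 𝕜 (X →L[𝕜] Y) :=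
  y.comp (ContinuousLinearMap.apply 𝕜 Y x)

theorem evalFunctional_apply (y : StrongDual 𝕜 Y) (x : X) (S : X →L[𝕜] Y) :
    evalFunctional y x S = y (S x) := rfl

theorem norm_evalFunctional_le_one {y : StrongDual 𝕜 Y} {x : X} (hy : ‖y‖ ≤ 1) (hx : ‖x‖ ≤ 1) :
    ‖evalFunctional y x‖ ≤ 1 := by
  refine ContinuousLinearMap.opNorm_le_bound _ zero_le_one fun S => ?_
  rw [evalFunctional_apply, one_mul]
  exact (y.le_of_opNorm_le hy (S x)).trans ((one_mul ‖S x‖).le.trans (S.unit_le_opNorm x hx))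

theorem RealExtremePoint.of_evalFunctional {T : X →L[𝕜] Y} (hT : ‖T‖ = 1) {y : StrongDual 𝕜 Y}
    {x : X} (hy : ‖y‖ ≤ 1) (hx : ‖x‖ ≤ 1)
    (he : RealExtremePoint 𝕜 (stateSet 𝕜 T) (evalFunctional y x)) :
    (‖x‖ = 1 ∧ ‖T x‖ = ‖T‖) ∧ RealExtremePoint 𝕜 (Metric.closedBall (0 : X) 1) x ∧
      RealExtremePoint 𝕜 {f : Y →L[𝕜] 𝕜 | ‖f‖ = 1 ∧ f (T x) = (‖T x‖ : 𝕜)} y := by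
  have hyT : y (T x) = 1 := he.1.2
  have h1 : 1 ≤ ‖y‖ * ‖T x‖ := by simpa [hyT] using y.le_opNorm (T x)
  have h2 : ‖T x‖ ≤ ‖x‖ := by simpa [hT] using T.le_opNorm x
  have h3 : ‖y‖ * ‖T x‖ ≤ 1 * ‖T x‖ := mul_le_mul_of_nonneg_right hy (norm_nonneg _)
  have hTx : ‖T x‖ = 1 := by linarith
  have hx1 : ‖x‖ = 1 := by linarith
  have hy1 : ‖y‖ = 1 := by rw [hTx] at h1; linarith
  refine ⟨⟨hx1, hTx.trans hT.symm⟩,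
    ⟨mem_closedBall_zero_iff.2 hx, fun a ha b hb t ht0 ht1 hab => ?_⟩,
    ⟨⟨hy1, by rw [hyT, hTx, RCLike.ofReal_one]⟩, fun a ha b hb t ht0 ht1 hab => ?_⟩⟩
  · rw [mem_closedBall_zero_iff] at ha hb
    have hle : ∀ c : X, ‖c‖ ≤ 1 → ‖y (T c)‖ ≤ 1 := fun c hc => by
      have h := (evalFunctional y c).le_of_opNorm_le (norm_evalFunctional_le_one hy hc) T
      rwa [hT, one_mul] at h
    have hyab : (t : 𝕜) * y (T a) + ((1 - t : ℝ) : 𝕜) * y (T b) = 1 := by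
      rw [← hyT, hab]
      simp only [map_add, map_smul, smul_eq_mul]
    obtain ⟨hTa, hTb⟩ := eq_one_and_eq_one_of_convex_comb ht0 (sub_pos.2 ht1)
      (add_sub_cancel _ _) (hle a ha) (hle b hb) hyab
    obtain ⟨h4, h5⟩ := he.2 (evalFunctional y a) ⟨norm_evalFunctional_le_one hy ha, hTa⟩
      (evalFunctional y b) ⟨norm_evalFunctional_le_one hy hb, hTb⟩ t ht0 ht1
      (ContinuousLinearMap.ext fun S => by
        simp only [add_apply, smul_apply, evalFunctional_apply]
        conv_lhs => rw [hab]
        simp only [map_add, map_smul])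
    have heq : ∀ c : X, evalFunctional y c = evalFunctional y x → c = x := fun c hc => by
      refine (SeparatingDual.eq_iff_forall_dual_eq (R := 𝕜)).2 fun g => ?_
      have h := DFunLike.congr_fun hc (g.smulRight (T x))
      simpa [evalFunctional_apply, hyT] using h
    exact ⟨heq a h4, heq b h5⟩
  · have hmem : ∀ c : StrongDual 𝕜 Y, ‖c‖ = 1 ∧ c (T x) = (‖T x‖ : 𝕜) →
        evalFunctional c x ∈ stateSet 𝕜 T := fun c hc =>
      ⟨norm_evalFunctional_le_one hc.1.le hx, by
        rw [evalFunctional_apply, hc.2, hTx, RCLike.ofReal_one]⟩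
    obtain ⟨h4, h5⟩ := he.2 _ (hmem a ha) _ (hmem b hb) t ht0 ht1
      (ContinuousLinearMap.ext fun S => by rw [hab]; rfl)
    obtain ⟨g, -, hg⟩ := exists_dual_vector'' 𝕜 x
    rw [hx1, RCLike.ofReal_one] at hg
    have heq : ∀ c : StrongDual 𝕜 Y, evalFunctional c x = evalFunctional y x → c = y :=
      fun c hc => ContinuousLinearMap.ext fun z => by
        have h := DFunLike.congr_fun hc (g.smulRight z)
        simpa [evalFunctional_apply, hg] using h
    exact ⟨heq a h4, heq b h5⟩

theorem exists_of_realExtremePoint_dual {Z : Type*} [NormedAddCommGroup Z] [NormedSpace 𝕜 Z]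
    {ι : Z →ₗᵢ[𝕜] (X →L[𝕜] Y)} (hι : ∀ S, IsCompactOperator (ι S))
    (hrefl : Function.Surjective (NormedSpace.inclusionInDoubleDual 𝕜 X)) {e : StrongDual 𝕜 Z}
    (he : RealExtremePoint 𝕜 {φ : StrongDual 𝕜 Z | ‖φ‖ ≤ 1} e) :
    ∃ (x : X) (y : StrongDual 𝕜 Y), ‖x‖ ≤ 1 ∧ ‖y‖ ≤ 1 ∧ ∀ S : Z, e S = y ((ι S) x) := by
  have := WeakDual.isScalarTower_real 𝕜 Z
  have he' : RealExtremePoint 𝕜 (WeakDual.unitBall 𝕜 Z) (StrongDual.toWeakDual e) := he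
  have hext := realExtremePoint_iff.1 he'
  obtain ⟨x, y, hx, hy, h⟩ := exists_of_mem_extremePoints_dual hι hrefl hext
  exact ⟨x, y, hx, hy, h⟩

/-- When the compact operators form an `M`-ideal close to `T`, and the domain is reflexive, the
extreme states at `T` are evaluations at norm-attaining extreme points. -/
theorem exists_evalFunctional_eq_of_realExtremePoint
    (hrefl : Function.Surjective (NormedSpace.inclusionInDoubleDual 𝕜 X))
    {P : StrongDual 𝕜 (X →L[𝕜] Y) →ₗ[𝕜] StrongDual 𝕜 (X →L[𝕜] Y)}
    (hPP : ∀ φ, P (P φ) = P φ) (hPnorm : ∀ φ, ‖φ‖ = ‖P φ‖ + ‖φ - P φ‖)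
    (hPrange : Set.range P = {φ | ∀ S : X →L[𝕜] Y, IsCompactOperator ⇑S → φ S = 0})
    {T : X →L[𝕜] Y} (hT : ‖T‖ = 1)
    (hdist : Metric.infDist T {S : X →L[𝕜] Y | IsCompactOperator ⇑S} < 1)
    {e : StrongDual 𝕜 (X →L[𝕜] Y)} (he : RealExtremePoint 𝕜 (stateSet 𝕜 T) e) :
    ∃ (x : X) (y : StrongDual 𝕜 Y), e = evalFunctional y x ∧ (‖x‖ = 1 ∧ ‖T x‖ = ‖T‖) ∧
      RealExtremePoint 𝕜 (Metric.closedBall (0 : X) 1) x ∧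
      RealExtremePoint 𝕜 {f : Y →L[𝕜] 𝕜 | ‖f‖ = 1 ∧ f (T x) = (‖T x‖ : 𝕜)} y := by
  obtain ⟨K, hK⟩ : ∃ K : Submodule 𝕜 (X →L[𝕜] Y), ∀ S, S ∈ K ↔ IsCompactOperator ⇑S :=
    ⟨compactOperator (RingHom.id 𝕜) X Y, fun _ => Iff.rfl⟩
  obtain ⟨k, hk, hTk⟩ := (Metric.infDist_lt_iff ⟨0, isCompactOperator_zero⟩).1 hdist
  rw [dist_eq_norm] at hTk
  have hkK : k ∈ K := (hK k).2 hk
  have hPK : ∀ φ, ∀ S ∈ K, P φ S = 0 := fun φ S hS =>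
    (hPrange.le (mem_range_self φ) : ∀ S : X →L[𝕜] Y, IsCompactOperator ⇑S → P φ S = 0) S
      ((hK S).1 hS)
  have hPrange' : ∀ φ : StrongDual 𝕜 (X →L[𝕜] Y), (∀ S ∈ K, φ S = 0) → φ ∈ Set.range P :=
    fun φ hφ => hPrange.ge fun S hS => hφ S ((hK S).2 hS)
  have hext := comp_subtypeL_mem_extremePoints hPP hPnorm hPK hPrange' hT hkK hTk he
  obtain ⟨x, y, hx, hy, hxy⟩ := exists_of_realExtremePoint_dual (ι := K.subtypeₗᵢ)
    (fun S : K => (hK S).1 S.2) hrefl hext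
  have heq : evalFunctional y x = e :=
    eq_of_eqOn_of_map_eq_zero hPP hPnorm hPrange' (one_le_norm_of_mem_stateSet hT he.1)
      (map_eq_zero_of_mem_stateSet hPnorm hPK hT hkK hTk he.1)
      (norm_evalFunctional_le_one hy hx) fun S hS => (hxy ⟨S, hS⟩).symm
  subst heq
  exact ⟨x, y, rfl, RealExtremePoint.of_evalFunctional hT hy hx he⟩

end EvalFunctional

section StateSet

variable {𝕜 E : Type*} [RCLike 𝕜] [NormedAddCommGroup E] [NormedSpace 𝕜 E]

theorem exists_mem_stateSet_forall_eq_zero {T : E} (hT : ‖T‖ = 1) {W : Submodule 𝕜 E}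
    (h : ∀ A ∈ W, ‖T‖ ≤ ‖T + A‖) : ∃ φ ∈ stateSet 𝕜 T, ∀ A ∈ W, φ A = 0 := by
  obtain ⟨g, hg, hgT⟩ := exists_dual_vector'' 𝕜 (Submodule.Quotient.mk T : E ⧸ W)
  have hle : ∀ S : E, ‖g (Submodule.Quotient.mk S)‖ ≤ 1 * ‖S‖ := fun S =>
    (g.le_of_opNorm_le hg _).trans
      (mul_le_mul_of_nonneg_left (Submodule.Quotient.norm_mk_le W S) zero_le_one)
  have hnorm : ‖(Submodule.Quotient.mk T : E ⧸ W)‖ = 1 := by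
    refine le_antisymm (hT ▸ Submodule.Quotient.norm_mk_le W T) ?_
    by_contra! hlt
    obtain ⟨m, hm, hm1⟩ := Submodule.Quotient.norm_mk_lt (Submodule.Quotient.mk T : E ⧸ W)
      (sub_pos.2 hlt)
    have h1 := h (m - T) ((Submodule.Quotient.eq W).1 hm)
    rw [add_sub_cancel] at h1
    linarith
  refine ⟨(g : E ⧸ W →ₗ[𝕜] 𝕜).comp W.mkQ |>.mkContinuous 1 hle,
    ⟨LinearMap.mkContinuous_norm_le _ zero_le_one hle, ?_⟩, fun A hA => ?_⟩
  · change g (Submodule.Quotient.mk T) = 1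
    rw [hgT, hnorm, RCLike.ofReal_one]
  · change g (Submodule.Quotient.mk A) = 0
    rw [(Submodule.Quotient.mk_eq_zero W).2 hA, map_zero]

/-- If the extreme points of a compact convex set lie in a finite-dimensional space, each of its
points is a finite convex combination of extreme points. -/
theorem exists_fin_convex_comb_realExtremePoint {F : Type*} [AddCommGroup F] [Module 𝕜 F]
    [Module ℝ F] [IsScalarTower ℝ 𝕜 F] [TopologicalSpace F] [T2Space F] [IsTopologicalAddGroup F]
    [ContinuousSMul ℝ F] [LocallyConvexSpace ℝ F] {s : Set F} (hs : IsCompact s)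
    (hsc : Convex ℝ s) (V : Submodule 𝕜 F) [FiniteDimensional 𝕜 V]
    (hV : ∀ e, RealExtremePoint 𝕜 s e → e ∈ V) {x : F} (hx : x ∈ s) :
    ∃ (n : ℕ) (e : Fin n → F) (lam : Fin n → ℝ),
      (∀ i, RealExtremePoint 𝕜 s (e i)) ∧ (∀ i, 0 < lam i) ∧ ∑ i, lam i = 1 ∧
      ∑ i, (lam i : 𝕜) • e i = x := by
  have : FiniteDimensional ℝ (V.restrictScalars ℝ) := by
    have : IsScalarTower ℝ 𝕜 V := ⟨fun r c v => Subtype.ext (smul_assoc r c (v : F))⟩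
    exact @Module.Finite.trans ℝ 𝕜 V _ _ _ _ _ _ this _ _
  have hmem := subset_convexHull_extremePoints_of_subset_submodule hs hsc (V.restrictScalars ℝ)
    (fun e he => hV e (realExtremePoint_iff.2 he)) hx
  obtain ⟨ι, _, z, w, hz, -, hw, hw1, hsum⟩ := eq_pos_convex_span_of_mem_convexHull hmem
  let f := (Fintype.equivFin ι).symm
  refine ⟨Fintype.card ι, z ∘ f, w ∘ f,
    fun i => realExtremePoint_iff.2 (hz (mem_range_self _)), fun i => hw _, ?_, ?_⟩
  · rw [← hw1]
    exact f.sum_comp w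
  · rw [← hsum]
    simp only [Function.comp_apply, RCLike.real_smul_eq_coe_smul (K := 𝕜)]
    exact f.sum_comp fun i => (w i : 𝕜) • z i

/-- The inclusion of the dual space into the space of all functions. -/
def dualToFun (𝕜 E : Type*) [RCLike 𝕜] [NormedAddCommGroup E] [NormedSpace 𝕜 E] :
    StrongDual 𝕜 E →ₗ[𝕜] (E → 𝕜) where
  toFun φ := φ
  map_add' _ _ := rfl
  map_smul' _ _ := rfl

theorem isCompact_image_stateSet (T : E) : IsCompact (dualToFun 𝕜 E '' stateSet 𝕜 T) := by
  have hcl : IsClosed {φ : WeakDual 𝕜 E | φ T = 1} :=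
    isClosed_eq (WeakDual.eval_continuous T) continuous_const
  exact ((WeakDual.isCompact_unitBall 𝕜 E).inter_right hcl).image
    (WeakDual.coeFn_continuous (𝕜 := 𝕜) (E := E))

theorem convex_stateSet (T : E) : Convex ℝ (stateSet 𝕜 T) := by
  intro a ha b hb α β hα hβ hαβ
  refine ⟨?_, ?_⟩
  · refine (norm_add_le _ _).trans ?_
    rw [norm_smul, norm_smul, Real.norm_of_nonneg hα, Real.norm_of_nonneg hβ]
    have h1 := mul_le_mul_of_nonneg_left ha.1 hα
    have h2 := mul_le_mul_of_nonneg_left hb.1 hβ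
    linarith
  · rw [add_apply, smul_apply, smul_apply, ha.2, hb.2, ← add_smul, hαβ, one_smul]

theorem convex_image_stateSet (T : E) : Convex ℝ (dualToFun 𝕜 E '' stateSet 𝕜 T) := by
  rintro _ ⟨a, ha, rfl⟩ _ ⟨b, hb, rfl⟩ α β hα hβ hαβ
  exact ⟨α • a + β • b, convex_stateSet T ha hb hα hβ hαβ, rfl⟩

theorem RealExtremePoint.of_image {F G : Type*} [AddCommGroup F] [Module 𝕜 F] [AddCommGroup G]
    [Module 𝕜 G] {L : F →ₗ[𝕜] G} (hL : Function.Injective L) {s : Set F} {e : F}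
    (he : RealExtremePoint 𝕜 (L '' s) (L e)) : RealExtremePoint 𝕜 s e := by
  refine ⟨hL.mem_set_image.1 he.1, fun a ha b hb t ht0 ht1 h => ?_⟩
  obtain ⟨h1, h2⟩ := he.2 _ (mem_image_of_mem L ha) _ (mem_image_of_mem L hb) t ht0 ht1
    (by rw [h, map_add, map_smul, map_smul])
  exact ⟨hL h1, hL h2⟩

/-- If the extreme states at `T` lie in a finite-dimensional space, each state is a finite convex
combination of extreme states. -/
theorem exists_convex_comb_of_mem_stateSet {T : E} (V : Submodule 𝕜 (StrongDual 𝕜 E))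
    [FiniteDimensional 𝕜 V] (hV : ∀ e, RealExtremePoint 𝕜 (stateSet 𝕜 T) e → e ∈ V)
    {φ : StrongDual 𝕜 E} (hφ : φ ∈ stateSet 𝕜 T) :
    ∃ (n : ℕ) (e : Fin n → StrongDual 𝕜 E) (lam : Fin n → ℝ),
      (∀ i, RealExtremePoint 𝕜 (stateSet 𝕜 T) (e i)) ∧ (∀ i, 0 < lam i) ∧ ∑ i, lam i = 1 ∧
      ∀ S, ∑ i, (lam i : 𝕜) * e i S = φ S := by
  have hinj : Function.Injective (dualToFun 𝕜 E) := DFunLike.coe_injective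
  obtain ⟨n, f, lam, hf, hlam, hlam1, hsum⟩ := exists_fin_convex_comb_realExtremePoint
    (isCompact_image_stateSet T) (convex_image_stateSet T) (V.map (dualToFun 𝕜 E))
    (fun f hf => by
      obtain ⟨e, -, rfl⟩ := hf.1
      exact Submodule.mem_map_of_mem (hV e (hf.of_image hinj)))
    (mem_image_of_mem _ hφ)
  choose e _ he using fun i => (hf i).1
  refine ⟨n, e, lam, fun i => ?_, hlam, hlam1, fun S => ?_⟩
  · have h := hf i
    rw [← he i] at h
    exact h.of_image hinj
  · have h := congrFun hsum S
    rw [Finset.sum_apply] at h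
    simp only [← he] at h
    exact h

end StateSet

section Evaluation

variable {𝕜 X Y : Type*} [RCLike 𝕜] [NormedAddCommGroup X] [NormedSpace 𝕜 X]
  [NormedAddCommGroup Y] [NormedSpace 𝕜 Y]

/-- The evaluation functionals at a fixed vector, as a linear function of the outer functional. -/
noncomputable def evalFunctionalₗ (Y : Type*) [NormedAddCommGroup Y] [NormedSpace 𝕜 Y] (x : X) :
    StrongDual 𝕜 Y →ₗ[𝕜] StrongDual 𝕜 (X →L[𝕜] Y) where
  toFun y := evalFunctional y x
  map_add' _ _ := rfl
  map_smul' _ _ := rfl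

/-- Evaluations at finitely many vectors, each with outer functional in a set of finite-dimensional
span, lie in a common finite-dimensional subspace. -/
theorem exists_finiteDimensional_evalFunctional_mem {s : Set X} (hs : s.Finite)
    {J : X → Set (StrongDual 𝕜 Y)}
    (hJ : ∀ x ∈ s, FiniteDimensional 𝕜 (Submodule.span 𝕜 (J x))) :
    ∃ V : Submodule 𝕜 (StrongDual 𝕜 (X →L[𝕜] Y)), FiniteDimensional 𝕜 V ∧
      ∀ x ∈ s, ∀ y ∈ J x, evalFunctional y x ∈ V := by
  have : Finite s := hs
  have (x : s) : FiniteDimensional 𝕜 (Submodule.span 𝕜 (J x)) := hJ x x.2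
  refine ⟨⨆ x : s, (Submodule.span 𝕜 (J x)).map (evalFunctionalₗ Y (x : X)),
    Submodule.finiteDimensional_iSup _, fun x hx y hy => ?_⟩
  exact Submodule.mem_iSup_of_mem ⟨x, hx⟩
    (Submodule.mem_map_of_mem (f := evalFunctionalₗ Y x) (Submodule.subset_span hy))

theorem norm_le_norm_add_of_convex_comb {T A : X →L[𝕜] Y} {ι : Type*} [Fintype ι] {x : ι → X}
    {y : ι → StrongDual 𝕜 Y} {lam : ι → ℝ} (hx : ∀ i, ‖x i‖ = 1) (hTx : ∀ i, ‖T (x i)‖ = ‖T‖)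
    (hy : ∀ i, ‖y i‖ = 1) (hyT : ∀ i, y i (T (x i)) = (‖T (x i)‖ : 𝕜)) (hlam : ∀ i, 0 < lam i)
    (hlam1 : ∑ i, lam i = 1) (hA : ∑ i, (lam i : 𝕜) * y i (A (x i)) = 0) :
    ‖T‖ ≤ ‖T + A‖ := by
  have h1 : ∑ i, (lam i : 𝕜) * y i ((T + A) (x i)) = (‖T‖ : 𝕜) := by
    simp only [add_apply, map_add, mul_add, Finset.sum_add_distrib, hA, hyT, hTx, add_zero]
    rw [← Finset.sum_mul, ← RCLike.ofReal_sum, hlam1, RCLike.ofReal_one, one_mul]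
  have h2 : ∀ i, ‖(lam i : 𝕜) * y i ((T + A) (x i))‖ ≤ lam i * ‖T + A‖ := fun i => by
    rw [norm_mul, RCLike.norm_of_nonneg (hlam i).le]
    have h3 := (evalFunctional (y i) (x i)).le_of_opNorm_le
      (norm_evalFunctional_le_one (hy i).le (hx i).le) (T + A)
    rw [one_mul] at h3
    exact mul_le_mul_of_nonneg_left h3 (hlam i).le
  calc ‖T‖ = ‖∑ i, (lam i : 𝕜) * y i ((T + A) (x i))‖ := by
        rw [h1, RCLike.norm_of_nonneg (norm_nonneg _)]
    _ ≤ ∑ i, lam i * ‖T + A‖ := norm_sum_le_of_le _ fun i _ => h2 i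
    _ = ‖T + A‖ := by rw [← Finset.sum_mul, hlam1, one_mul]

end Evaluation

end

/-- **Theorem (orthogonality to a subspace, arbitrary range space).**
Let `X` be a reflexive Banach space, `Y` an arbitrary Banach space, and suppose the
compact operators `K(X,Y)` form an `M`-ideal in `L(X,Y)` (i.e. the annihilator of
`K(X,Y)` is the range of an `L`-projection on the dual of `L(X,Y)`).
Let `T ∈ L(X,Y)` be such that (i) `‖T‖ = 1` and `dist(T, K(X,Y)) < 1`;
(ii) `M_T ∩ Ext(B_X)` is finite; (iii) for each `x ∈ M_T ∩ Ext(B_X)` the span of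
`J(Tx)` is finite-dimensional. Then for any subspace `W` of `L(X,Y)`, `T ⊥_B W`
iff there exist `n ≥ 1`, `x_i ∈ M_T ∩ Ext(B_X)`, `y_i* ∈ Ext(J(T x_i))` and
`λ_i > 0` with `∑ λ_i = 1` such that `∑ λ_i y_i*(A x_i) = 0` for all `A ∈ W`. -/
theorem birkhoff_orthogonality_subspace_Mideal
    {𝕜 X Y : Type*} [RCLike 𝕜]
    [NormedAddCommGroup X] [NormedSpace 𝕜 X] [CompleteSpace X]
    [NormedAddCommGroup Y] [NormedSpace 𝕜 Y] [CompleteSpace Y]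
    (hrefl : Function.Surjective (NormedSpace.inclusionInDoubleDual 𝕜 X))
    (hMideal : ∃ P : ((X →L[𝕜] Y) →L[𝕜] 𝕜) →ₗ[𝕜] ((X →L[𝕜] Y) →L[𝕜] 𝕜),
      (∀ φ, P (P φ) = P φ) ∧ (∀ φ, ‖φ‖ = ‖P φ‖ + ‖φ - P φ‖) ∧
      (Set.range P = {φ | ∀ S : X →L[𝕜] Y, IsCompactOperator ⇑S → φ S = 0}))
    (T : X →L[𝕜] Y) (hT : ‖T‖ = 1)
    (hdist : Metric.infDist T {S : X →L[𝕜] Y | IsCompactOperator ⇑S} < 1)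
    (hMTfin : Set.Finite {x : X | (‖x‖ = 1 ∧ ‖T x‖ = ‖T‖) ∧
      RealExtremePoint 𝕜 (Metric.closedBall (0 : X) 1) x})
    (hJfin : ∀ x : X, (‖x‖ = 1 ∧ ‖T x‖ = ‖T‖) →
      RealExtremePoint 𝕜 (Metric.closedBall (0 : X) 1) x →
      FiniteDimensional 𝕜 (Submodule.span 𝕜
        {f : Y →L[𝕜] 𝕜 | ‖f‖ = 1 ∧ f (T x) = (‖T x‖ : 𝕜)}))
    (W : Submodule 𝕜 (X →L[𝕜] Y)) :
    (∀ A ∈ W, ∀ c : 𝕜, ‖T‖ ≤ ‖T + c • A‖) ↔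
      ∃ (n : ℕ), 1 ≤ n ∧
        ∃ (x : Fin n → X) (ystar : Fin n → (Y →L[𝕜] 𝕜)) (lam : Fin n → ℝ),
          (∀ i, ‖x i‖ = 1 ∧ ‖T (x i)‖ = ‖T‖ ∧
            RealExtremePoint 𝕜 (Metric.closedBall (0 : X) 1) (x i)) ∧
          (∀ i, RealExtremePoint 𝕜
            {f : Y →L[𝕜] 𝕜 | ‖f‖ = 1 ∧ f (T (x i)) = (‖T (x i)‖ : 𝕜)} (ystar i)) ∧
          (∀ i, 0 < lam i) ∧ (∑ i, lam i = 1) ∧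
          (∀ A ∈ W, ∑ i, ((lam i : 𝕜)) * (ystar i) (A (x i)) = 0) := by
  obtain ⟨P, hPP, hPnorm, hPrange⟩ := hMideal
  constructor
  · intro h
    obtain ⟨φ, hφ, hφW⟩ := exists_mem_stateSet_forall_eq_zero hT (W := W) fun A hA => by
      simpa using h A hA 1
    obtain ⟨V, hVfin, hV⟩ := exists_finiteDimensional_evalFunctional_mem hMTfin
      (J := fun x => {f : Y →L[𝕜] 𝕜 | ‖f‖ = 1 ∧ f (T x) = (‖T x‖ : 𝕜)})
      fun x hx => hJfin x hx.1 hx.2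
    have hext := fun e (he : RealExtremePoint 𝕜 (stateSet 𝕜 T) e) =>
      exists_evalFunctional_eq_of_realExtremePoint hrefl hPP hPnorm hPrange hT hdist he
    obtain ⟨n, e, lam, he, hlam, hlam1, hsum⟩ := exists_convex_comb_of_mem_stateSet V
      (fun e he => by
        obtain ⟨x, y, rfl, hx, hxe, hy⟩ := hext e he
        exact hV x ⟨hx, hxe⟩ y hy.1) hφ
    choose x y hexy hx hxe hy using fun i => hext (e i) (he i)
    refine ⟨n, Nat.one_le_iff_ne_zero.2 ?_, x, y, lam,
      fun i => ⟨(hx i).1, (hx i).2, hxe i⟩, hy, hlam, hlam1, fun A hA => ?_⟩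
    · rintro rfl
      simp at hlam1
    · rw [← hφW A hA, ← hsum A]
      simp only [hexy, evalFunctional_apply]
  · rintro ⟨n, -, x, y, lam, hx, hy, hlam, hlam1, hsum⟩ A hA c
    exact norm_le_norm_add_of_convex_comb (fun i => (hx i).1) (fun i => (hx i).2.1)
      (fun i => (hy i).1.1) (fun i => (hy i).1.2) hlam hlam1 (hsum _ (W.smul_mem c hA))
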